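/- arXiv:2006.09486 — 3 statements merged into one kernel-verified Lean document; each statement's English description precedes it below -/
import Mathlib

section
/- Suppose (A1) the gradients of L_S and L_D are L-Lipschitz on W × Φ with L > 0, (A2) L_D is M-Lipschitz, (A3) (w,φ) ↦ ∇²_w L_S(w,φ) is ρ-Lipschitz and (w,φ) ↦ ∇_φ∇_w L_S(w,φ) is τ-Lipschitz in operator norm, and α > 0. Then for every N ≥ 1 and all (w₁,φ₁), (w₂,φ₂) ∈ W × Φ: ‖G_φ(w₁,φ₁) − G_φ(w₂,φ₂)‖ ≤ (ατMN(1 + αL)^{N−1} + (2L + ρM/L)(1 + αL)^{2N}) (‖w₁ − w₂‖ + ‖φ₁ − φ₂‖). -/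
noncomputable section

open scoped RealInnerProductSpace

abbrev Wsp (p : ℕ) := EuclideanSpace ℝ (Fin p)

/-- Partial gradient in the first block of variables. -/
def gradW {p q : ℕ} (f : Wsp p × Wsp q → ℝ) (w : Wsp p) (φ : Wsp q) : Wsp p :=
  gradient (fun u => f (u, φ)) w

/-- Partial gradient in the second block of variables. -/
def gradPhi {p q : ℕ} (f : Wsp p × Wsp q → ℝ) (w : Wsp p) (φ : Wsp q) : Wsp q :=
  gradient (fun ψ => f (w, ψ)) φ

/-- Inner-loop gradient descent iterates. -/
def innerIter {p q : ℕ} (f : Wsp p × Wsp q → ℝ) (α : ℝ) : ℕ → Wsp p → Wsp q → Wsp p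
  | 0, w, _ => w
  | (m+1), w, φ => innerIter f α m w φ - α • gradW f (innerIter f α m w φ) φ

/-- Hessian in `w` of `f(·,φ)` at `w`, as a continuous linear map. -/
def hessW {p q : ℕ} (f : Wsp p × Wsp q → ℝ) (w : Wsp p) (φ : Wsp q) : Wsp p →L[ℝ] Wsp p :=
  fderiv ℝ (fun u => gradW f u φ) w

/-- Mixed second derivative `∇_φ∇_w f (w,φ)`, viewed as a linear map `W → Φ`. -/
def crossD {p q : ℕ} (f : Wsp p × Wsp q → ℝ) (w : Wsp p) (φ : Wsp q) : Wsp p →L[ℝ] Wsp q :=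
  ContinuousLinearMap.adjoint (fderiv ℝ (fun ψ => gradW f w ψ) φ)

/-- Ordered product `A a * A (a+1) * ⋯ * A (b-1)` (factor `A a` leftmost, i.e. applied last). -/
def prodIco {p : ℕ} (A : ℕ → (Wsp p →L[ℝ] Wsp p)) (a b : ℕ) : Wsp p →L[ℝ] Wsp p :=
  ((List.range (b - a)).map (fun k => A (a + k))).prod

/-- `f(·,φ)` is `μc`-strongly convex in `w`, for every `φ`. -/
def StrongConvexIn {p q : ℕ} (μc : ℝ) (f : Wsp p × Wsp q → ℝ) : Prop :=
  ∀ (w w' : Wsp p) (φ : Wsp q),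
    f (w', φ) ≥ f (w, φ) + ⟪w' - w, gradW f w φ⟫ + μc / 2 * ‖w - w'‖ ^ 2

/-- The (full) gradient of `f` is `L`-Lipschitz on `W × Φ` (Euclidean norms). -/
def GradLip {p q : ℕ} (L : ℝ) (f : Wsp p × Wsp q → ℝ) : Prop :=
  ∀ (w₁ w₂ : Wsp p) (φ₁ φ₂ : Wsp q),
    Real.sqrt (‖gradW f w₁ φ₁ - gradW f w₂ φ₂‖ ^ 2 + ‖gradPhi f w₁ φ₁ - gradPhi f w₂ φ₂‖ ^ 2)
      ≤ L * Real.sqrt (‖w₁ - w₂‖ ^ 2 + ‖φ₁ - φ₂‖ ^ 2)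

/-- `f` is `M`-Lipschitz on `W × Φ` (Euclidean norms). -/
def FunLip {p q : ℕ} (M : ℝ) (f : Wsp p × Wsp q → ℝ) : Prop :=
  ∀ (w₁ w₂ : Wsp p) (φ₁ φ₂ : Wsp q),
    |f (w₁, φ₁) - f (w₂, φ₂)| ≤ M * Real.sqrt (‖w₁ - w₂‖ ^ 2 + ‖φ₁ - φ₂‖ ^ 2)

/-- `(w,φ) ↦ ∇²_w f(w,φ)` is `ρ`-Lipschitz in operator norm. -/
def HessLip {p q : ℕ} (ρ : ℝ) (f : Wsp p × Wsp q → ℝ) : Prop :=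
  ∀ (w₁ w₂ : Wsp p) (φ₁ φ₂ : Wsp q),
    ‖hessW f w₁ φ₁ - hessW f w₂ φ₂‖ ≤ ρ * Real.sqrt (‖w₁ - w₂‖ ^ 2 + ‖φ₁ - φ₂‖ ^ 2)

/-- `(w,φ) ↦ ∇_φ∇_w f(w,φ)` is `τ`-Lipschitz in operator norm. -/
def CrossLip {p q : ℕ} (τ : ℝ) (f : Wsp p × Wsp q → ℝ) : Prop :=
  ∀ (w₁ w₂ : Wsp p) (φ₁ φ₂ : Wsp q),
    ‖crossD f w₁ φ₁ - crossD f w₂ φ₂‖ ≤ τ * Real.sqrt (‖w₁ - w₂‖ ^ 2 + ‖φ₁ - φ₂‖ ^ 2)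

section Helpers

variable {p q : ℕ}

lemma aux_gradW_eq {f : Wsp p × Wsp q → ℝ} (hf : Differentiable ℝ f) (w : Wsp p) (φ : Wsp q) :
    gradW f w φ = (InnerProductSpace.toDual ℝ (Wsp p)).symm
      ((fderiv ℝ f (w, φ)).comp (ContinuousLinearMap.inl ℝ (Wsp p) (Wsp q))) := by
  unfold gradW gradient
  congr 1
  have h : HasFDerivAt (fun u : Wsp p => ((u, φ) : Wsp p × Wsp q))
      (ContinuousLinearMap.inl ℝ (Wsp p) (Wsp q)) w := hasFDerivAt_prodMk_left w φ
  exact ((hf (w, φ)).hasFDerivAt.comp w h).fderiv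

lemma aux_gradPhi_eq {f : Wsp p × Wsp q → ℝ} (hf : Differentiable ℝ f) (w : Wsp p) (φ : Wsp q) :
    gradPhi f w φ = (InnerProductSpace.toDual ℝ (Wsp q)).symm
      ((fderiv ℝ f (w, φ)).comp (ContinuousLinearMap.inr ℝ (Wsp p) (Wsp q))) := by
  unfold gradPhi gradient
  congr 1
  have h : HasFDerivAt (fun u : Wsp q => ((w, u) : Wsp p × Wsp q))
      (ContinuousLinearMap.inr ℝ (Wsp p) (Wsp q)) φ := hasFDerivAt_prodMk_right w φ
  exact ((hf (w, φ)).hasFDerivAt.comp φ h).fderiv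

lemma aux_gradW_diff {f : Wsp p × Wsp q → ℝ} (hf : ContDiff ℝ 2 f) :
    Differentiable ℝ (fun x : Wsp p × Wsp q => gradW f x.1 x.2) := by
  have hd : Differentiable ℝ f := hf.differentiable (by norm_num)
  have h1 : Differentiable ℝ (fderiv ℝ f) :=
    (hf.fderiv_right (m := 1) (by norm_num)).differentiable (by norm_num)
  have : (fun x : Wsp p × Wsp q => gradW f x.1 x.2) = fun x =>
      (InnerProductSpace.toDual ℝ (Wsp p)).symm
      ((fderiv ℝ f x).comp (ContinuousLinearMap.inl ℝ (Wsp p) (Wsp q))) := by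
    funext x; exact aux_gradW_eq hd x.1 x.2
  rw [this]
  exact ((InnerProductSpace.toDual ℝ (Wsp p)).symm.toContinuousLinearEquiv.differentiable).comp
    (h1.clm_comp (differentiable_const _))

/-- Derivative of the inner iterates in `φ`. -/
def iterD (f : Wsp p × Wsp q → ℝ) (α : ℝ) : ℕ → Wsp p → Wsp q → (Wsp q →L[ℝ] Wsp p)
  | 0, _, _ => 0
  | (m+1), w, φ => iterD f α m w φ
      - α • ((hessW f (innerIter f α m w φ) φ).comp (iterD f α m w φ)
        + ContinuousLinearMap.adjoint (crossD f (innerIter f α m w φ) φ))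

lemma aux_iter_hasFDerivAt {f : Wsp p × Wsp q → ℝ} (hf : ContDiff ℝ 2 f) (α : ℝ) (w : Wsp p)
    (φ : Wsp q) (m : ℕ) :
    HasFDerivAt (fun ψ => innerIter f α m w ψ) (iterD f α m w φ) φ := by
  induction m with
  | zero => exact hasFDerivAt_const w φ
  | succ m ih =>
    set x := innerIter f α m w φ with hx
    have hg := (aux_gradW_diff hf (x, φ)).hasFDerivAt
    set F := fderiv ℝ (fun x : Wsp p × Wsp q => gradW f x.1 x.2) (x, φ) with hF
    have hH : hessW f x φ = F.comp (ContinuousLinearMap.inl ℝ (Wsp p) (Wsp q)) :=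
      (HasFDerivAt.comp (f := fun u : Wsp p => ((u, φ) : Wsp p × Wsp q))
        (g := fun x : Wsp p × Wsp q => gradW f x.1 x.2) x hg (hasFDerivAt_prodMk_left x φ)).fderiv
    have hC : ContinuousLinearMap.adjoint (crossD f x φ)
        = F.comp (ContinuousLinearMap.inr ℝ (Wsp p) (Wsp q)) := by
      unfold crossD
      rw [ContinuousLinearMap.adjoint_adjoint]
      exact (HasFDerivAt.comp (f := fun u : Wsp q => ((x, u) : Wsp p × Wsp q))
        (g := fun x : Wsp p × Wsp q => gradW f x.1 x.2) φ hg (hasFDerivAt_prodMk_right x φ)).fderiv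
    have hc : HasFDerivAt (fun ψ => gradW f (innerIter f α m w ψ) ψ)
        (F.comp ((iterD f α m w φ).prod (ContinuousLinearMap.id ℝ (Wsp q)))) φ :=
      HasFDerivAt.comp (f := fun ψ => (innerIter f α m w ψ, ψ))
        (g := fun x : Wsp p × Wsp q => gradW f x.1 x.2) φ hg (ih.prodMk (hasFDerivAt_id φ))
    have := ih.sub (hc.const_smul α)
    have he : iterD f α (m+1) w φ = iterD f α m w φ
        - α • (F.comp ((iterD f α m w φ).prod (ContinuousLinearMap.id ℝ (Wsp q)))) := by
      simp only [iterD]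
      rw [← hx, hH, hC]
      congr 2
      ext1 v
      simp [← map_add]
    rw [he]
    exact this

lemma aux_gradient_eq {f g : Wsp p × Wsp q → ℝ} (hf : ContDiff ℝ 2 f) (hg : Differentiable ℝ g)
    (α : ℝ) (w : Wsp p) (φ : Wsp q) (m : ℕ) :
    gradient (fun ψ => g (innerIter f α m w ψ, ψ)) φ =
      ContinuousLinearMap.adjoint (iterD f α m w φ) (gradW g (innerIter f α m w φ) φ)
        + gradPhi g (innerIter f α m w φ) φ := by
  have h := HasFDerivAt.comp (f := fun ψ => (innerIter f α m w ψ, ψ)) (g := g) φ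
    (hg (innerIter f α m w φ, φ)).hasFDerivAt
    ((aux_iter_hasFDerivAt hf α w φ m).prodMk (hasFDerivAt_id φ))
  refine ext_inner_right ℝ fun v => ?_
  have h2 : gradient (fun ψ => g (innerIter f α m w ψ, ψ)) φ =
    (InnerProductSpace.toDual ℝ (Wsp q)).symm ((fderiv ℝ g (innerIter f α m w φ, φ)).comp
      ((iterD f α m w φ).prod (ContinuousLinearMap.id ℝ (Wsp q)))) := by
    unfold gradient
    congr 1
    exact h.fderiv
  rw [h2, aux_gradW_eq hg, aux_gradPhi_eq hg, inner_add_left,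
    ContinuousLinearMap.adjoint_inner_left]
  simp [← map_add]

lemma aux_sqrt_le {a b : ℝ} (ha : 0 ≤ a) (hb : 0 ≤ b) : Real.sqrt (a ^ 2 + b ^ 2) ≤ a + b := by
  rw [Real.sqrt_le_left (by positivity)]
  nlinarith [mul_nonneg ha hb]

lemma aux_gradW_lip {f : Wsp p × Wsp q → ℝ} {L : ℝ} (h : GradLip L f)
    (w₁ w₂ : Wsp p) (φ₁ φ₂ : Wsp q) :
    ‖gradW f w₁ φ₁ - gradW f w₂ φ₂‖ ≤ L * Real.sqrt (‖w₁ - w₂‖ ^ 2 + ‖φ₁ - φ₂‖ ^ 2) :=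
  (Real.le_sqrt_of_sq_le (by nlinarith [sq_nonneg ‖gradPhi f w₁ φ₁ - gradPhi f w₂ φ₂‖])).trans
    (h w₁ w₂ φ₁ φ₂)

lemma aux_gradPhi_lip {f : Wsp p × Wsp q → ℝ} {L : ℝ} (h : GradLip L f)
    (w₁ w₂ : Wsp p) (φ₁ φ₂ : Wsp q) :
    ‖gradPhi f w₁ φ₁ - gradPhi f w₂ φ₂‖ ≤ L * Real.sqrt (‖w₁ - w₂‖ ^ 2 + ‖φ₁ - φ₂‖ ^ 2) :=
  (Real.le_sqrt_of_sq_le (by nlinarith [sq_nonneg ‖gradW f w₁ φ₁ - gradW f w₂ φ₂‖])).trans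
    (h w₁ w₂ φ₁ φ₂)

lemma aux_hess_bd {f : Wsp p × Wsp q → ℝ} {L : ℝ} (hL : 0 ≤ L) (h : GradLip L f)
    (w : Wsp p) (φ : Wsp q) : ‖hessW f w φ‖ ≤ L := by
  refine norm_fderiv_le_of_lip' ℝ hL (Filter.Eventually.of_forall fun u => ?_)
  simpa [Real.sqrt_sq] using aux_gradW_lip h u w φ φ

lemma aux_cross_bd {f : Wsp p × Wsp q → ℝ} {L : ℝ} (hL : 0 ≤ L) (h : GradLip L f)
    (w : Wsp p) (φ : Wsp q) : ‖crossD f w φ‖ ≤ L := by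
  unfold crossD
  rw [LinearIsometryEquiv.norm_map]
  refine norm_fderiv_le_of_lip' ℝ hL (Filter.Eventually.of_forall fun u => ?_)
  simpa [Real.sqrt_sq] using aux_gradW_lip h w w u φ

lemma aux_gradW_bd {f : Wsp p × Wsp q → ℝ} {M : ℝ} (hM : 0 ≤ M) (h : FunLip M f)
    (w : Wsp p) (φ : Wsp q) : ‖gradW f w φ‖ ≤ M := by
  unfold gradW gradient
  rw [LinearIsometryEquiv.norm_map]
  refine norm_fderiv_le_of_lip' ℝ hM (Filter.Eventually.of_forall fun u => ?_)
  simpa [Real.sqrt_sq] using h u w φ φ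

lemma aux_iter_lip {f : Wsp p × Wsp q → ℝ} {L α : ℝ} (hL : 0 ≤ L) (hα : 0 ≤ α) (h : GradLip L f)
    (w₁ w₂ : Wsp p) (φ₁ φ₂ : Wsp q) (m : ℕ) :
    ‖innerIter f α m w₁ φ₁ - innerIter f α m w₂ φ₂‖ + ‖φ₁ - φ₂‖
      ≤ (1 + α * L) ^ m * (‖w₁ - w₂‖ + ‖φ₁ - φ₂‖) := by
  induction m with
  | zero => simp [innerIter]
  | succ m ih =>
    simp only [innerIter]
    set x := innerIter f α m w₁ φ₁
    set y := innerIter f α m w₂ φ₂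
    have h1 : ‖(x - α • gradW f x φ₁) - (y - α • gradW f y φ₂)‖
        ≤ ‖x - y‖ + α * (L * (‖x - y‖ + ‖φ₁ - φ₂‖)) := by
      have : (x - α • gradW f x φ₁) - (y - α • gradW f y φ₂)
        = (x - y) - α • (gradW f x φ₁ - gradW f y φ₂) := by module
      rw [this]
      refine (norm_sub_le _ _).trans ?_
      rw [norm_smul, Real.norm_of_nonneg hα]
      gcongr
      refine (aux_gradW_lip h x y φ₁ φ₂).trans ?_
      gcongr
      exact aux_sqrt_le (norm_nonneg _) (norm_nonneg _)
    have h2 : (1 + α * L) * (‖x - y‖ + ‖φ₁ - φ₂‖)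
        ≤ (1 + α * L) * ((1 + α * L) ^ m * (‖w₁ - w₂‖ + ‖φ₁ - φ₂‖)) :=
      mul_le_mul_of_nonneg_left ih (by positivity)
    rw [pow_succ']
    linarith

lemma aux_iterD_bd {f : Wsp p × Wsp q → ℝ} {L α : ℝ} (hL : 0 ≤ L) (hα : 0 ≤ α) (h : GradLip L f)
    (w : Wsp p) (φ : Wsp q) (m : ℕ) : ‖iterD f α m w φ‖ ≤ (1 + α * L) ^ m - 1 := by
  induction m with
  | zero => simp [iterD]
  | succ m ih =>
    simp only [iterD]
    refine (norm_sub_le _ _).trans ?_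
    rw [norm_smul, Real.norm_of_nonneg hα]
    have h1 := norm_add_le
      ((hessW f (innerIter f α m w φ) φ).comp (iterD f α m w φ))
      (ContinuousLinearMap.adjoint (crossD f (innerIter f α m w φ) φ))
    rw [LinearIsometryEquiv.norm_map] at h1
    have h2 := ContinuousLinearMap.opNorm_comp_le
      (hessW f (innerIter f α m w φ) φ) (iterD f α m w φ)
    have h3 := aux_cross_bd hL h (innerIter f α m w φ) φ
    have h4 : ‖hessW f (innerIter f α m w φ) φ‖ * ‖iterD f α m w φ‖
        ≤ L * ((1 + α * L) ^ m - 1) :=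
      mul_le_mul (aux_hess_bd hL h _ _) ih (norm_nonneg _) hL
    have h5 := mul_le_mul_of_nonneg_left (h1.trans (add_le_add (h2.trans h4) h3)) hα
    rw [pow_succ]
    linarith

lemma aux_iterD_lip {f : Wsp p × Wsp q → ℝ} {L α ρ τ : ℝ} (hL : 0 < L) (hα : 0 < α)
    (hρ : 0 ≤ ρ) (hτ : 0 ≤ τ)
    (h : GradLip L f) (hH : HessLip ρ f) (hC : CrossLip τ f)
    (w₁ w₂ : Wsp p) (φ₁ φ₂ : Wsp q) (m : ℕ) :
    (1 + α * L) * ‖iterD f α m w₁ φ₁ - iterD f α m w₂ φ₂‖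
      ≤ (α * τ * m * (1 + α * L) ^ m
        + ρ / L * (1 + α * L) ^ (m + 1) * ((1 + α * L) ^ m - 1))
        * (‖w₁ - w₂‖ + ‖φ₁ - φ₂‖) := by
  induction m with
  | zero => simp [iterD]
  | succ m ih =>
    have hx := aux_iter_lip hL.le hα.le h w₁ w₂ φ₁ φ₂ m
    have hD := aux_iterD_bd hL.le hα.le h w₂ φ₂ m
    simp only [iterD]
    set x := innerIter f α m w₁ φ₁
    set y := innerIter f α m w₂ φ₂
    set A := iterD f α m w₁ φ₁
    set B := iterD f α m w₂ φ₂
    set δ := ‖w₁ - w₂‖ + ‖φ₁ - φ₂‖ with hδ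
    have hδ0 : 0 ≤ δ := by positivity
    have hs := (aux_sqrt_le (norm_nonneg (x - y)) (norm_nonneg (φ₁ - φ₂))).trans hx
    have e1 := (hH x y φ₁ φ₂).trans (mul_le_mul_of_nonneg_left hs hρ)
    have e2 := (hC x y φ₁ φ₂).trans (mul_le_mul_of_nonneg_left hs hτ)
    set k := 1 + α * L with hk
    have hk1 : 1 ≤ k := by rw [hk]; nlinarith [mul_pos hα hL]
    have hK1 : 1 ≤ k ^ m := one_le_pow₀ hk1
    have key : ‖(A - α • ((hessW f x φ₁).comp A + ContinuousLinearMap.adjoint (crossD f x φ₁)))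
        - (B - α • ((hessW f y φ₂).comp B + ContinuousLinearMap.adjoint (crossD f y φ₂)))‖
        ≤ k * ‖A - B‖ + α * (ρ * (k ^ m * δ) * (k ^ m - 1)) + α * (τ * (k ^ m * δ)) := by
      have e : (A - α • ((hessW f x φ₁).comp A + ContinuousLinearMap.adjoint (crossD f x φ₁)))
        - (B - α • ((hessW f y φ₂).comp B + ContinuousLinearMap.adjoint (crossD f y φ₂)))
        = (A - B) - α • ((hessW f x φ₁).comp (A - B) + (hessW f x φ₁ - hessW f y φ₂).comp B
          + ContinuousLinearMap.adjoint (crossD f x φ₁ - crossD f y φ₂)) := by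
        rw [ContinuousLinearMap.comp_sub, ContinuousLinearMap.sub_comp, map_sub]
        module
      rw [e]
      refine (norm_sub_le _ _).trans ?_
      rw [norm_smul, Real.norm_of_nonneg hα.le]
      have n1 : ‖(hessW f x φ₁).comp (A - B) + (hessW f x φ₁ - hessW f y φ₂).comp B
          + ContinuousLinearMap.adjoint (crossD f x φ₁ - crossD f y φ₂)‖
          ≤ L * ‖A - B‖ + ρ * (k ^ m * δ) * (k ^ m - 1) + τ * (k ^ m * δ) := by
        refine (norm_add₃_le).trans ?_
        refine add_le_add (add_le_add ?_ ?_) ?_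
        · exact (ContinuousLinearMap.opNorm_comp_le _ _).trans
            (mul_le_mul_of_nonneg_right (aux_hess_bd hL.le h _ _) (norm_nonneg _))
        · exact (ContinuousLinearMap.opNorm_comp_le _ _).trans
            (mul_le_mul e1 hD (norm_nonneg _) (by positivity))
        · rw [LinearIsometryEquiv.norm_map]; exact e2
      have := mul_le_mul_of_nonneg_left n1 hα.le
      rw [hk] at this ⊢
      linarith
    have hk0 : 0 < k := by linarith
    refine (mul_le_mul_of_nonneg_left key hk0.le).trans ?_
    have s1 := mul_le_mul_of_nonneg_left ih hk0.le
    have hαk : α = (k - 1) / L := by rw [hk]; field_simp; ring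
    set K := k ^ m with hKd
    have r : 0 ≤ ρ / L * (k * K) * δ * ((k * (k * K - 1)) - (K - 1) * (2 * k - 1)) := by
      have : 0 ≤ (k * (k * K - 1)) - (K - 1) * (2 * k - 1) := by
        nlinarith [mul_nonneg (sub_nonneg.2 hK1) (sq_nonneg (k - 1)),
          mul_nonneg hk0.le (sub_nonneg.2 hk1)]
      positivity
    have t : α * (ρ * (K * δ) * (K - 1)) = ρ / L * K * δ * (K - 1) * (k - 1) := by
      rw [hαk]; field_simp
    rw [mul_add, mul_add, t]
    have p1 : k ^ (m + 1) = k * K := pow_succ' k m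
    have p2 : k ^ (m + 1 + 1) = k * (k * K) := by rw [pow_succ', p1]
    rw [p1] at s1
    rw [p2, p1]
    push_cast
    nlinarith [s1, r]

end Helpers

/-- Proposition 3, part 2: smoothness of the task meta-gradient in `φ`
in the nonconvex case. -/
theorem anil_meta_grad_phi_smooth_nonconvex (p q : ℕ) (LS LD : Wsp p × Wsp q → ℝ)
    (hLS : ContDiff ℝ 2 LS) (hLD : ContDiff ℝ 2 LD) (L M ρ τ α : ℝ)
    (hLipS : GradLip L LS) (hLipD : GradLip L LD) (hL : 0 < L)
    (hFunD : FunLip M LD) (hHess : HessLip ρ LS) (hCross : CrossLip τ LS) (hα : 0 < α) :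
    ∀ (N : ℕ), 1 ≤ N → ∀ (w₁ w₂ : Wsp p) (φ₁ φ₂ : Wsp q),
      ‖gradient (fun ψ => LD (innerIter LS α N w₁ ψ, ψ)) φ₁
          - gradient (fun ψ => LD (innerIter LS α N w₂ ψ, ψ)) φ₂‖
        ≤ (α * τ * M * N * (1 + α * L) ^ (N - 1)
              + (2 * L + ρ * M / L) * (1 + α * L) ^ (2 * N))
            * (‖w₁ - w₂‖ + ‖φ₁ - φ₂‖) := by
  intro N hN w₁ w₂ φ₁ φ₂
  by_cases hz : w₁ = w₂ ∧ φ₁ = φ₂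
  · obtain ⟨rfl, rfl⟩ := hz
    simp
  have hpos : 0 < Real.sqrt (‖w₁ - w₂‖ ^ 2 + ‖φ₁ - φ₂‖ ^ 2) := by
    apply Real.sqrt_pos.2
    rcases not_and_or.1 hz with h | h
    · have := norm_pos_iff.2 (sub_ne_zero.2 h)
      positivity
    · have := norm_pos_iff.2 (sub_ne_zero.2 h)
      positivity
  have hM : 0 ≤ M := nonneg_of_mul_nonneg_left ((abs_nonneg _).trans (hFunD w₁ w₂ φ₁ φ₂)) hpos
  have hρ : 0 ≤ ρ := nonneg_of_mul_nonneg_left ((norm_nonneg _).trans (hHess w₁ w₂ φ₁ φ₂)) hpos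
  have hτ : 0 ≤ τ := nonneg_of_mul_nonneg_left ((norm_nonneg _).trans (hCross w₁ w₂ φ₁ φ₂)) hpos
  have hdD : Differentiable ℝ LD := hLD.differentiable (by norm_num)
  rw [aux_gradient_eq hLS hdD, aux_gradient_eq hLS hdD]
  have hx := aux_iter_lip hL.le hα.le hLipS w₁ w₂ φ₁ φ₂ N
  have hD := aux_iterD_bd hL.le hα.le hLipS w₂ φ₂ N
  have hE := aux_iterD_lip hL hα hρ hτ hLipS hHess hCross w₁ w₂ φ₁ φ₂ N
  set x := innerIter LS α N w₁ φ₁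
  set y := innerIter LS α N w₂ φ₂
  set A := iterD LS α N w₁ φ₁
  set B := iterD LS α N w₂ φ₂
  set δ := ‖w₁ - w₂‖ + ‖φ₁ - φ₂‖ with hδ
  have hδ0 : 0 ≤ δ := by positivity
  have hs := (aux_sqrt_le (norm_nonneg (x - y)) (norm_nonneg (φ₁ - φ₂))).trans hx
  have g1 := (aux_gradW_lip hLipD x y φ₁ φ₂).trans (mul_le_mul_of_nonneg_left hs hL.le)
  have g2 := (aux_gradPhi_lip hLipD x y φ₁ φ₂).trans (mul_le_mul_of_nonneg_left hs hL.le)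
  have g3 := aux_gradW_bd hM hFunD x φ₁
  set k := 1 + α * L with hk
  have hk1 : 1 ≤ k := by rw [hk]; nlinarith [mul_pos hα hL]
  have hk0 : 0 < k := by linarith
  have hK1 : 1 ≤ k ^ N := one_le_pow₀ hk1
  have e : (ContinuousLinearMap.adjoint A (gradW LD x φ₁) + gradPhi LD x φ₁)
      - (ContinuousLinearMap.adjoint B (gradW LD y φ₂) + gradPhi LD y φ₂)
      = ContinuousLinearMap.adjoint (A - B) (gradW LD x φ₁)
        + ContinuousLinearMap.adjoint B (gradW LD x φ₁ - gradW LD y φ₂)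
        + (gradPhi LD x φ₁ - gradPhi LD y φ₂) := by
    rw [map_sub, map_sub, ContinuousLinearMap.sub_apply]
    abel
  rw [e]
  have n1 : ‖ContinuousLinearMap.adjoint (A - B) (gradW LD x φ₁)‖ ≤ ‖A - B‖ * M := by
    refine (ContinuousLinearMap.le_opNorm _ _).trans ?_
    rw [LinearIsometryEquiv.norm_map]
    exact mul_le_mul_of_nonneg_left g3 (norm_nonneg _)
  have n2 : ‖ContinuousLinearMap.adjoint B (gradW LD x φ₁ - gradW LD y φ₂)‖
      ≤ (k ^ N - 1) * (L * (k ^ N * δ)) := by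
    refine (ContinuousLinearMap.le_opNorm _ _).trans ?_
    rw [LinearIsometryEquiv.norm_map]
    exact mul_le_mul hD g1 (norm_nonneg _) (by linarith)
  refine norm_add₃_le.trans ((add_le_add (add_le_add n1 n2) g2).trans ?_)
  obtain ⟨n, rfl⟩ : ∃ n, N = n + 1 := ⟨N - 1, by omega⟩
  have hE2 : ‖A - B‖ ≤ (α * τ * ((n + 1 : ℕ) : ℝ) * k ^ n
      + ρ / L * k ^ (n + 1) * (k ^ (n + 1) - 1)) * δ := by
    refine le_of_mul_le_mul_left (hE.trans (le_of_eq ?_)) hk0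
    ring
  have hE3 := mul_le_mul_of_nonneg_right hE2 hM
  have p2 : k ^ (2 * (n + 1)) = k ^ (n + 1) * k ^ (n + 1) := by ring
  rw [p2, Nat.add_sub_cancel]
  have r1 : 0 ≤ L * (k ^ (n + 1) * k ^ (n + 1)) * δ := by positivity
  have r2 : 0 ≤ ρ / L * k ^ (n + 1) * δ * M := by positivity
  have r3 : ρ * M / L = ρ / L * M := by ring
  rw [r3]
  nlinarith [hE3, r1, r2]
end
end

section
/- Let F : W × Φ → ℝ be differentiable and suppose ℓ₁, ℓ₂, ℓ₃ ≥ 0 are such that for every fixed φ the map w ↦ ∇_w F(w,φ) is ℓ₁-Lipschitz, for every fixed w the map φ ↦ ∇_φ F(w,φ) is ℓ₃-Lipschitz, and for every fixed φ the map w ↦ ∇_φ F(w,φ) is ℓ₂-Lipschitz. Then for all (w,φ), (w′,φ′) ∈ W × Φ: F(w′,φ′) ≤ F(w,φ) + ⟨∇_w F(w,φ), w′ − w⟩ + ((ℓ₁ + ℓ₂)/2)‖w′ − w‖² + ⟨∇_φ F(w,φ), φ′ − φ⟩ + ((ℓ₂ + ℓ₃)/2)‖φ′ − φ‖². -/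
noncomputable section

open scoped RealInnerProductSpace

/-- Descent lemma for a function with Lipschitz gradient. -/
theorem descent_aux {n : ℕ} (f : Wsp n → ℝ) (hf : Differentiable ℝ f) (L : ℝ)
    (hL : ∀ x y : Wsp n, ‖gradient f x - gradient f y‖ ≤ L * ‖x - y‖) (x y : Wsp n) :
    f y ≤ f x + ⟪gradient f x, y - x⟫ + L / 2 * ‖y - x‖ ^ 2 := by
  set d := y - x with hd
  have hder : ∀ t : ℝ, HasDerivAt (fun t : ℝ => f (x + t • d)) ⟪gradient f (x + t • d), d⟫ t := by
    intro t
    have hl : HasDerivAt (fun t : ℝ => x + t • d) d t := by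
      simpa using ((hasDerivAt_id t).smul_const d).const_add x
    have h := (hf (x + t • d)).hasGradientAt.hasFDerivAt.comp_hasDerivAt t hl
    refine HasDerivAt.congr_deriv (f := fun t : ℝ => f (x + t • d)) h ?_
    simp
  have hB : ∀ t : ℝ, HasDerivAt
      (fun t : ℝ => f x + t * ⟪gradient f x, d⟫ + L / 2 * t ^ 2 * ‖d‖ ^ 2)
      (⟪gradient f x, d⟫ + L * t * ‖d‖ ^ 2) t := by
    intro t
    have h := (((hasDerivAt_id t).mul_const ⟪gradient f x, d⟫).const_add (f x)).add
      ((((hasDerivAt_id t).pow 2).const_mul (L / 2)).mul_const (‖d‖ ^ 2))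
    refine h.congr_deriv ?_
    simp only [id, Nat.cast_ofNat]
    ring
  have key := image_le_of_deriv_right_le_deriv_boundary (a := 0) (b := 1)
    (fun t _ => (hder t).continuousAt.continuousWithinAt)
    (fun t _ => (hder t).hasDerivWithinAt) (by simp)
    (fun t _ => (hB t).continuousAt.continuousWithinAt)
    (fun t _ => (hB t).hasDerivWithinAt)
    (by
      intro t ht
      have h1 := hL (x + t • d) x
      have h2 := real_inner_le_norm (gradient f (x + t • d) - gradient f x) d
      rw [inner_sub_left] at h2
      rw [add_sub_cancel_left, norm_smul, Real.norm_of_nonneg ht.1] at h1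
      have h3 := mul_le_mul_of_nonneg_right h1 (norm_nonneg d)
      nlinarith) (Set.right_mem_Icc.2 zero_le_one)
  simpa [hd] using key

/-- block descent lemma for a function of two blocks of variables with
block-Lipschitz partial gradients. -/
theorem block_descent_lemma (p q : ℕ) (F : Wsp p × Wsp q → ℝ)
    (hF : Differentiable ℝ F) (ℓ₁ ℓ₂ ℓ₃ : ℝ)
    (h₁ : 0 ≤ ℓ₁) (h₂ : 0 ≤ ℓ₂) (h₃ : 0 ≤ ℓ₃)
    (hW : ∀ (φ : Wsp q) (w₁ w₂ : Wsp p),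
      ‖gradW F w₁ φ - gradW F w₂ φ‖ ≤ ℓ₁ * ‖w₁ - w₂‖)
    (hΦ : ∀ (w : Wsp p) (φ₁ φ₂ : Wsp q),
      ‖gradPhi F w φ₁ - gradPhi F w φ₂‖ ≤ ℓ₃ * ‖φ₁ - φ₂‖)
    (hX : ∀ (φ : Wsp q) (w₁ w₂ : Wsp p),
      ‖gradPhi F w₁ φ - gradPhi F w₂ φ‖ ≤ ℓ₂ * ‖w₁ - w₂‖) :
    ∀ (w w' : Wsp p) (φ φ' : Wsp q),
      F (w', φ') ≤ F (w, φ) + ⟪gradW F w φ, w' - w⟫ + (ℓ₁ + ℓ₂) / 2 * ‖w' - w‖ ^ 2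
        + ⟪gradPhi F w φ, φ' - φ⟫ + (ℓ₂ + ℓ₃) / 2 * ‖φ' - φ‖ ^ 2 := by
  intro w w' φ φ'
  have a := descent_aux (fun u => F (u, φ)) (by fun_prop) ℓ₁ (hW φ) w w'
  have b := descent_aux (fun v => F (w', v)) (by fun_prop) ℓ₃ (hΦ w') φ φ'
  have c := real_inner_le_norm (gradPhi F w' φ - gradPhi F w φ) (φ' - φ)
  rw [inner_sub_left] at c
  have e := mul_le_mul_of_nonneg_right (hX φ w' w) (norm_nonneg (φ' - φ))
  have g := mul_nonneg h₂ (sq_nonneg (‖w' - w‖ - ‖φ' - φ‖))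
  change F (w', φ) ≤ F (w, φ) + ⟪gradW F w φ, w' - w⟫ + ℓ₁ / 2 * ‖w' - w‖ ^ 2 at a
  change F (w', φ') ≤ F (w', φ) + ⟪gradPhi F w' φ, φ' - φ⟫ + ℓ₃ / 2 * ‖φ' - φ‖ ^ 2 at b
  linarith
end
end

section
/- Suppose L_S is twice continuously differentiable, its gradient is L-Lipschitz on W × Φ, (w,φ) ↦ ∇²_w L_S(w,φ) is ρ-Lipschitz in operator norm, L_S(·,φ) is μ-strongly convex in w for every φ with 0 < μ < L, and α = μ/L². Set δ := 1 − αμ and, for 0 ≤ m ≤ N−2, U_m(w,φ) := ∏_{j=m+1}^{N−1}(I − α∇²_w L_S(w_j(w,φ),φ)) (ordered with the j = m+1 factor leftmost). Then for all (w₁,φ₁), (w₂,φ₂) ∈ W × Φ: ‖U_m(w₁,φ₁) − U_m(w₂,φ₂)‖ ≤ (αρ/(1−αμ) + 2ρ/μ) δ^{N−1−m/2} ‖w₁ − w₂‖ + α(N−1−m) ρ(1 + 2L/μ) δ^{N−2−m} ‖φ₁ − φ₂‖ (operator norm). -/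
noncomputable section

open scoped RealInnerProductSpace

namespace AnilAux

lemma opnorm_of_form {p : ℕ} (B : Wsp p →L[ℝ] Wsp p) (δ : ℝ) (hδ : 0 ≤ δ)
    (hs : ∀ u v, ⟪B u, v⟫ = ⟪B v, u⟫) (h0 : ∀ v, 0 ≤ ⟪B v, v⟫)
    (h1 : ∀ v, ⟪B v, v⟫ ≤ δ * ‖v‖ ^ 2) : ‖B‖ ≤ δ := by
  refine B.opNorm_le_bound hδ fun v => ?_
  by_cases hx : B v = 0
  · rw [hx, norm_zero]; positivity
  have hv : v ≠ 0 := by rintro rfl; simp at hx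
  have hxn : 0 < ‖B v‖ := norm_pos_iff.mpr hx
  have hvn : 0 < ‖v‖ := norm_pos_iff.mpr hv
  set c : ℝ := ‖v‖ / ‖B v‖ with hc
  have hcp : 0 < c := by positivity
  have a1 := h1 (v + c • B v)
  have a2 := h0 (v - c • B v)
  have hn : ‖v + c • B v‖ ≤ 2 * ‖v‖ := by
    refine (norm_add_le _ _).trans ?_
    rw [norm_smul, Real.norm_of_nonneg hcp.le, hc, div_mul_cancel₀ _ hxn.ne']
    linarith
  have hn2 : ‖v + c • B v‖ ^ 2 ≤ (2 * ‖v‖) ^ 2 := by gcongr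
  have hsym := hs (B v) v
  simp only [map_add, map_sub, map_smul, inner_add_left, inner_add_right, inner_sub_left,
    inner_sub_right, inner_smul_left, inner_smul_right, hsym, real_inner_self_eq_norm_sq,
    conj_trivial] at a1 a2
  have h3 : δ * ‖v + c • B v‖ ^ 2 ≤ δ * (2 * ‖v‖) ^ 2 := by gcongr
  have h4 : c * ‖B v‖ ^ 2 ≤ δ * ‖v‖ ^ 2 := by nlinarith
  have h5 : c * ‖B v‖ ^ 2 = ‖v‖ * ‖B v‖ := by rw [hc]; field_simp
  rw [h5] at h4
  have : ‖v‖ * ‖B v‖ ≤ ‖v‖ * (δ * ‖v‖) := by nlinarith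
  exact le_of_mul_le_mul_left this hvn

variable {p q : ℕ} {LS : Wsp p × Wsp q → ℝ}

lemma cd_slice (hLS : ContDiff ℝ 2 LS) (φ : Wsp q) : ContDiff ℝ 2 (fun u => LS (u, φ)) :=
  hLS.comp (contDiff_id.prodMk contDiff_const)

lemma diff_fderiv (hLS : ContDiff ℝ 2 LS) (φ : Wsp q) :
    Differentiable ℝ (fderiv ℝ (fun u => LS (u, φ))) :=
  ((cd_slice hLS φ).fderiv_right (m := 1) (by norm_num)).differentiable (by norm_num)

/-- The inverse Riesz map as a real-linear continuous map. -/
def riesz (p : ℕ) : StrongDual ℝ (Wsp p) →L[ℝ] Wsp p :=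
  LinearMap.mkContinuous
    { toFun := fun l => (InnerProductSpace.toDual ℝ (Wsp p)).symm l
      map_add' := fun x y => map_add _ x y
      map_smul' := fun c x => by simp } 1 (fun x => by simp)

lemma grad_hasFDerivAt (hLS : ContDiff ℝ 2 LS) (φ : Wsp q) (w : Wsp p) :
    HasFDerivAt (fun u => gradW LS u φ)
      ((riesz p).comp
        (fderiv ℝ (fderiv ℝ (fun u => LS (u, φ))) w)) w := by
  have h := (diff_fderiv hLS φ w).hasFDerivAt
  exact (riesz p).hasFDerivAt.comp w h

lemma grad_diff (hLS : ContDiff ℝ 2 LS) (φ : Wsp q) :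
    Differentiable ℝ (fun u => gradW LS u φ) :=
  fun w => (grad_hasFDerivAt hLS φ w).differentiableAt

lemma hess_inner (hLS : ContDiff ℝ 2 LS) (φ : Wsp q) (w u v : Wsp p) :
    ⟪hessW LS w φ u, v⟫ = fderiv ℝ (fderiv ℝ (fun u => LS (u, φ))) w u v := by
  have h : hessW LS w φ u = (InnerProductSpace.toDual ℝ (Wsp p)).symm
      (fderiv ℝ (fderiv ℝ (fun u => LS (u, φ))) w u) := by
    unfold hessW
    rw [(grad_hasFDerivAt hLS φ w).fderiv]
    rfl
  rw [h, InnerProductSpace.toDual_symm_apply]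

lemma hess_symm (hLS : ContDiff ℝ 2 LS) (φ : Wsp q) (w u v : Wsp p) :
    ⟪hessW LS w φ u, v⟫ = ⟪hessW LS w φ v, u⟫ := by
  rw [hess_inner hLS, hess_inner hLS]
  have := ((cd_slice hLS φ).contDiffAt (x := w)).isSymmSndFDerivAt (by simp)
  exact this u v

lemma grad_mono {μc : ℝ} (hSC : StrongConvexIn μc LS) (φ : Wsp q) (w w' : Wsp p) :
    μc * ‖w' - w‖ ^ 2 ≤ ⟪gradW LS w' φ - gradW LS w φ, w' - w⟫ := by
  have h1 := hSC w w' φ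
  have h2 := hSC w' w φ
  rw [norm_sub_rev] at h1
  have h3 : w - w' = -(w' - w) := by abel
  rw [h3, inner_neg_left] at h2
  rw [inner_sub_left, real_inner_comm, real_inner_comm (w' - w) (gradW LS w φ)]
  linarith

lemma hess_lower {μc : ℝ} (hLS : ContDiff ℝ 2 LS) (hSC : StrongConvexIn μc LS) (φ : Wsp q)
    (w v : Wsp p) : μc * ‖v‖ ^ 2 ≤ ⟪hessW LS w φ v, v⟫ := by
  have hd : HasDerivAt (fun t : ℝ => ⟪gradW LS (w + t • v) φ, v⟫ - t * (μc * ‖v‖ ^ 2))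
      (⟪hessW LS w φ v, v⟫ - μc * ‖v‖ ^ 2) 0 := by
    have hl : HasDerivAt (fun t : ℝ => w + t • v) v 0 := by
      simpa using ((hasDerivAt_id (0:ℝ)).smul_const v).const_add w
    have hg : HasFDerivAt (fun u => gradW LS u φ) (hessW LS w φ) (w + (0:ℝ) • v) := by
      rw [zero_smul, add_zero]
      exact (grad_diff hLS φ w).hasFDerivAt
    have hc := hg.comp_hasDerivAt (0:ℝ) hl
    have h1 := hc.inner ℝ (hasDerivAt_const (0:ℝ) v)
    have h2 := (hasDerivAt_id (0:ℝ)).mul_const (μc * ‖v‖ ^ 2)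
    have h3 := h1.sub h2
    simp only [inner_zero_right, zero_add, one_mul] at h3
    exact h3
  have hm : Monotone (fun t : ℝ => ⟪gradW LS (w + t • v) φ, v⟫ - t * (μc * ‖v‖ ^ 2)) := by
    intro s t hst
    rcases hst.eq_or_lt with rfl | hlt
    · exact le_rfl
    have h := grad_mono hSC φ (w + s • v) (w + t • v)
    have he : w + t • v - (w + s • v) = (t - s) • v := by rw [sub_smul]; abel
    rw [he, norm_smul, inner_smul_right, mul_pow, Real.norm_eq_abs, sq_abs, inner_sub_left] at h
    have hp : 0 < t - s := sub_pos.mpr hlt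
    have : (t - s) * ((t - s) * (μc * ‖v‖ ^ 2)) ≤
        (t - s) * (⟪gradW LS (w + t • v) φ, v⟫ - ⟪gradW LS (w + s • v) φ, v⟫) := by
      linarith
    have := le_of_mul_le_mul_left this hp
    simp only
    linarith
  have := hm.deriv_nonneg (x := 0)
  rw [hd.deriv] at this
  linarith

lemma grad_lip {L : ℝ} (hLip : GradLip L LS) (hL : 0 ≤ L) (w₁ w₂ : Wsp p) (φ₁ φ₂ : Wsp q) :
    ‖gradW LS w₁ φ₁ - gradW LS w₂ φ₂‖ ≤ L * Real.sqrt (‖w₁ - w₂‖ ^ 2 + ‖φ₁ - φ₂‖ ^ 2) := by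
  refine le_trans ?_ (hLip w₁ w₂ φ₁ φ₂)
  apply Real.le_sqrt_of_sq_le
  have := sq_nonneg ‖gradPhi LS w₁ φ₁ - gradPhi LS w₂ φ₂‖
  linarith

lemma hess_norm {L : ℝ} (hLip : GradLip L LS) (hL : 0 ≤ L) (w : Wsp p) (φ : Wsp q) :
    ‖hessW LS w φ‖ ≤ L := by
  have h : LipschitzWith L.toNNReal (fun u => gradW LS u φ) := by
    apply LipschitzWith.of_dist_le_mul
    intro x y
    have := grad_lip hLip hL x y φ φ
    simp only [sub_self, norm_zero] at this
    rw [dist_eq_norm, dist_eq_norm, Real.coe_toNNReal L hL]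
    simpa [Real.sqrt_sq] using this
  have := norm_fderiv_le_of_lipschitz ℝ h (x₀ := w)
  rwa [Real.coe_toNNReal L hL] at this

lemma factor_norm {L μc α : ℝ} (hLS : ContDiff ℝ 2 LS) (hLip : GradLip L LS)
    (hSC : StrongConvexIn μc LS) (hL : 0 ≤ L) (hα : 0 ≤ α) (hαL : α * L ≤ 1)
    (hδ : 0 ≤ 1 - α * μc) (w : Wsp p) (φ : Wsp q) :
    ‖(1 : Wsp p →L[ℝ] Wsp p) - α • hessW LS w φ‖ ≤ 1 - α * μc := by
  apply opnorm_of_form _ _ hδ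
  · intro u v
    simp only [sub_apply, smul_apply,
      one_apply_eq_self, inner_sub_left, inner_smul_left]
    rw [hess_symm hLS, real_inner_comm]
  · intro v
    simp only [sub_apply, smul_apply,
      one_apply_eq_self, inner_sub_left, inner_smul_left, conj_trivial,
      real_inner_self_eq_norm_sq]
    have h1 : ⟪hessW LS w φ v, v⟫ ≤ L * ‖v‖ ^ 2 := by
      refine (real_inner_le_norm _ _).trans ?_
      have := (hessW LS w φ).le_of_opNorm_le (hess_norm hLip hL w φ) v
      nlinarith [norm_nonneg v]
    have h2 : α * ⟪hessW LS w φ v, v⟫ ≤ α * (L * ‖v‖ ^ 2) := by gcongr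
    nlinarith [sq_nonneg ‖v‖]
  · intro v
    simp only [sub_apply, smul_apply,
      one_apply_eq_self, inner_sub_left, inner_smul_left, conj_trivial,
      real_inner_self_eq_norm_sq]
    have h2 := mul_le_mul_of_nonneg_left (hess_lower hLS hSC φ w v) hα
    linarith

lemma step_lip {L μc α : ℝ} (hLS : ContDiff ℝ 2 LS) (hLip : GradLip L LS)
    (hSC : StrongConvexIn μc LS) (hL : 0 ≤ L) (hα : 0 ≤ α) (hαL : α * L ≤ 1)
    (hδ : 0 ≤ 1 - α * μc) (x y : Wsp p) (φ : Wsp q) :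
    ‖(x - α • gradW LS x φ) - (y - α • gradW LS y φ)‖ ≤ (1 - α * μc) * ‖x - y‖ := by
  have hd : ∀ z ∈ (Set.univ : Set (Wsp p)), HasFDerivWithinAt (fun u => u - α • gradW LS u φ)
      ((1 : Wsp p →L[ℝ] Wsp p) - α • hessW LS z φ) Set.univ z := by
    intro z _
    exact ((hasFDerivAt_id z).sub
      ((grad_diff hLS φ z).hasFDerivAt.const_smul α)).hasFDerivWithinAt
  exact convex_univ.norm_image_sub_le_of_norm_hasFDerivWithin_le hd
    (fun z _ => factor_norm hLS hLip hSC hL hα hαL hδ z φ) (Set.mem_univ y) (Set.mem_univ x)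

lemma iter_lip {L μc α : ℝ} (hLS : ContDiff ℝ 2 LS) (hLip : GradLip L LS)
    (hSC : StrongConvexIn μc LS) (hL : 0 ≤ L) (hμ : 0 < μc) (hα : 0 ≤ α) (hαL : α * L ≤ 1)
    (hδ : 0 ≤ 1 - α * μc) (w₁ w₂ : Wsp p) (φ₁ φ₂ : Wsp q) (j : ℕ) :
    ‖innerIter LS α j w₁ φ₁ - innerIter LS α j w₂ φ₂‖ ≤
      (1 - α * μc) ^ j * ‖w₁ - w₂‖ + L / μc * ‖φ₁ - φ₂‖ := by
  induction j with
  | zero =>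
    simp only [innerIter, pow_zero, one_mul]
    have : 0 ≤ L / μc * ‖φ₁ - φ₂‖ := by positivity
    linarith
  | succ j ih =>
    simp only [innerIter]
    set x := innerIter LS α j w₁ φ₁
    set y := innerIter LS α j w₂ φ₂
    have e : x - α • gradW LS x φ₁ - (y - α • gradW LS y φ₂) =
        ((x - α • gradW LS x φ₁) - (y - α • gradW LS y φ₁))
          - α • (gradW LS y φ₁ - gradW LS y φ₂) := by
      rw [smul_sub]; abel
    rw [e]
    refine (norm_sub_le _ _).trans ?_
    have h1 := step_lip hLS hLip hSC hL hα hαL hδ x y φ₁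
    have h2 := grad_lip hLip hL y y φ₁ φ₂
    simp only [sub_self, norm_zero] at h2
    rw [zero_pow two_ne_zero, zero_add, Real.sqrt_sq (norm_nonneg _)] at h2
    rw [norm_smul, Real.norm_of_nonneg hα]
    have h3 : α * ‖gradW LS y φ₁ - gradW LS y φ₂‖ ≤ α * (L * ‖φ₁ - φ₂‖) := by gcongr
    have h4 := mul_le_mul_of_nonneg_left ih hδ
    have h5 : (1 - α * μc) * (L / μc * ‖φ₁ - φ₂‖) + α * (L * ‖φ₁ - φ₂‖)
        = L / μc * ‖φ₁ - φ₂‖ := by field_simp; ring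
    rw [pow_succ]
    linarith

lemma prod_norm (A : ℕ → (Wsp p →L[ℝ] Wsp p)) (δ : ℝ) (hδ : 0 ≤ δ) (hA : ∀ k, ‖A k‖ ≤ δ)
    (n : ℕ) : ‖((List.range n).map A).prod‖ ≤ δ ^ n := by
  induction n with
  | zero => 
    simp only [List.range_zero, List.map_nil, List.prod_nil, pow_zero]
    exact ContinuousLinearMap.norm_id_le (𝕜 := ℝ) (E := Wsp p)
  | succ n ih =>
    rw [List.range_succ, List.map_append, List.prod_append, pow_succ]
    simp only [List.map_cons, List.map_nil, List.prod_cons, List.prod_nil, mul_one]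
    refine (norm_mul_le _ _).trans ?_
    have := hA n
    gcongr

lemma prod_diff (A B : ℕ → (Wsp p →L[ℝ] Wsp p)) (δ : ℝ) (hδ : 0 ≤ δ) (hA : ∀ k, ‖A k‖ ≤ δ)
    (hB : ∀ k, ‖B k‖ ≤ δ) (e : ℕ → ℝ) (he : ∀ k, ‖A k - B k‖ ≤ e k) (n : ℕ) :
    ‖((List.range (n + 1)).map A).prod - ((List.range (n + 1)).map B).prod‖
      ≤ δ ^ n * ∑ k ∈ Finset.range (n + 1), e k := by
  induction n with
  | zero => simpa using he 0
  | succ n ih =>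
    rw [List.range_succ, List.map_append, List.prod_append, List.map_append, List.prod_append]
    simp only [List.map_cons, List.map_nil, List.prod_cons, List.prod_nil, mul_one]
    set P := ((List.range (n + 1)).map A).prod
    set Q := ((List.range (n + 1)).map B).prod with hQ
    have hQn : ‖Q‖ ≤ δ ^ (n + 1) := prod_norm B δ hδ hB (n + 1)
    have e1 : P * A (n + 1) - Q * B (n + 1) = (P - Q) * A (n + 1) + Q * (A (n + 1) - B (n + 1)) := by
      rw [sub_mul, mul_sub]; abel
    rw [e1, Finset.sum_range_succ _ (n + 1)]
    refine (norm_add_le _ _).trans ?_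
    have h1 : ‖(P - Q) * A (n + 1)‖ ≤ (δ ^ n * ∑ k ∈ Finset.range (n + 1), e k) * δ :=
      (norm_mul_le _ _).trans (mul_le_mul ih (hA _) (norm_nonneg _) ((norm_nonneg _).trans ih))
    have h2 : ‖Q * (A (n + 1) - B (n + 1))‖ ≤ δ ^ (n + 1) * e (n + 1) :=
      (norm_mul_le _ _).trans (mul_le_mul hQn (he _) (norm_nonneg _) (by positivity))
    calc _ ≤ _ := add_le_add h1 h2
      _ = _ := by ring

end AnilAux

/-- Lipschitz bound on the partial ordered products
`U_m = ∏_{j=m+1}^{N-1}(I - α∇²_w L_S(w_j,φ))` under a strongly-convex inner loop. -/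
theorem anil_partial_product_lipschitz_sc (p q : ℕ) (LS : Wsp p × Wsp q → ℝ)
    (hLS : ContDiff ℝ 2 LS) (L ρ μc α δ : ℝ)
    (hLip : GradLip L LS) (hHess : HessLip ρ LS) (hSC : StrongConvexIn μc LS)
    (hμ : 0 < μc) (hμL : μc < L) (hα : α = μc / L ^ 2) (hδ : δ = 1 - α * μc)
    (N : ℕ) (hN : 2 ≤ N) :
    ∀ (m : ℕ), m ≤ N - 2 → ∀ (w₁ w₂ : Wsp p) (φ₁ φ₂ : Wsp q),
      ‖prodIco (fun j => 1 - α • hessW LS (innerIter LS α j w₁ φ₁) φ₁) (m + 1) N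
          - prodIco (fun j => 1 - α • hessW LS (innerIter LS α j w₂ φ₂) φ₂) (m + 1) N‖
        ≤ (α * ρ / (1 - α * μc) + 2 * ρ / μc) * δ ^ ((N : ℝ) - 1 - (m : ℝ) / 2) * ‖w₁ - w₂‖
          + α * ((N : ℝ) - 1 - m) * ρ * (1 + 2 * L / μc) * δ ^ (N - 2 - m) * ‖φ₁ - φ₂‖ := by
  intro m hm w₁ w₂ φ₁ φ₂
  have hL : 0 < L := hμ.trans hμL
  have hαp : 0 < α := by rw [hα]; positivity
  have hαL : α * L < 1 := by
    rw [hα]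
    have : μc / L ^ 2 * L = μc / L := by field_simp
    rw [this, div_lt_one hL]; exact hμL
  have hαμ : α * μc < 1 := (mul_lt_mul_of_pos_left hμL hαp).trans hαL
  have hδp : 0 < δ := by rw [hδ]; linarith
  have hδ1 : δ < 1 := by rw [hδ]; have := mul_pos hαp hμ; linarith
  rw [← hδ]
  by_cases hρ : ρ < 0
  · have h := (norm_nonneg _).trans (hHess w₁ w₂ φ₁ φ₂)
    have hs : Real.sqrt (‖w₁ - w₂‖ ^ 2 + ‖φ₁ - φ₂‖ ^ 2) = 0 := by
      have := Real.sqrt_nonneg (‖w₁ - w₂‖ ^ 2 + ‖φ₁ - φ₂‖ ^ 2)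
      nlinarith
    rw [Real.sqrt_eq_zero (by positivity)] at hs
    have hw : ‖w₁ - w₂‖ = 0 := by nlinarith [sq_nonneg ‖w₁ - w₂‖, sq_nonneg ‖φ₁ - φ₂‖]
    have hp : ‖φ₁ - φ₂‖ = 0 := by nlinarith [sq_nonneg ‖w₁ - w₂‖, sq_nonneg ‖φ₁ - φ₂‖]
    rw [norm_sub_eq_zero_iff] at hw hp
    subst hw hp
    simp
  push Not at hρ
  obtain ⟨n, rfl⟩ : ∃ n, N = m + 2 + n := ⟨N - 2 - m, by omega⟩
  have i1 : m + 2 + n - (m + 1) = n + 1 := by omega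
  have i2 : m + 2 + n - 2 - m = n := by omega
  unfold prodIco
  rw [i1, i2]
  have hδ0 : 0 ≤ 1 - α * μc := by linarith
  have hf : ∀ w φ, ‖(1 : Wsp p →L[ℝ] Wsp p) - α • hessW LS w φ‖ ≤ δ := fun w φ => by
    rw [hδ]; exact AnilAux.factor_norm hLS hLip hSC hL.le hαp.le hαL.le hδ0 w φ
  have key := AnilAux.prod_diff
    (fun k => 1 - α • hessW LS (innerIter LS α (m + 1 + k) w₁ φ₁) φ₁)
    (fun k => 1 - α • hessW LS (innerIter LS α (m + 1 + k) w₂ φ₂) φ₂) δ hδp.le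
    (fun k => hf _ _) (fun k => hf _ _)
    (fun k => α * ρ * ‖w₁ - w₂‖ * δ ^ (m + 1) * δ ^ k + α * ρ * (1 + L / μc) * ‖φ₁ - φ₂‖) ?_ n
  · refine key.trans ?_
    rw [Finset.sum_add_distrib, ← Finset.mul_sum, Finset.sum_const, Finset.card_range, nsmul_eq_mul,
      mul_add]
    refine add_le_add ?_ ?_
    · have hg : ∑ k ∈ Finset.range (n + 1), δ ^ k ≤ 1 / (α * μc) := by
        rw [le_div_iff₀ (mul_pos hαp hμ)]
        have h1 := geom_sum_mul_neg δ (n + 1)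
        have h2 : 1 - δ = α * μc := by rw [hδ]; ring
        rw [h2] at h1
        rw [h1]
        have := pow_pos hδp (n + 1)
        linarith
      have hr : δ ^ (m + 1 + n) ≤ δ ^ (((m + 2 + n : ℕ) : ℝ) - 1 - (m : ℝ) / 2) := by
        rw [← Real.rpow_natCast]
        apply Real.rpow_le_rpow_of_exponent_ge hδp hδ1.le
        push_cast
        have : (0:ℝ) ≤ m := by positivity
        linarith
      calc δ ^ n * (α * ρ * ‖w₁ - w₂‖ * δ ^ (m + 1) * ∑ k ∈ Finset.range (n + 1), δ ^ k)
          ≤ δ ^ n * (α * ρ * ‖w₁ - w₂‖ * δ ^ (m + 1) * (1 / (α * μc))) := by gcongr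
        _ = ρ / μc * δ ^ (m + 1 + n) * ‖w₁ - w₂‖ := by
          rw [pow_add δ (m + 1) n]; field_simp
        _ ≤ (α * ρ / δ + 2 * ρ / μc) * δ ^ (m + 1 + n) * ‖w₁ - w₂‖ := by
          gcongr
          have a1 : 0 ≤ α * ρ / δ := by positivity
          have a2 : 0 ≤ ρ / μc := by positivity
          have a3 : 2 * ρ / μc = 2 * (ρ / μc) := by ring
          linarith
        _ ≤ _ := by gcongr
    · push_cast
      have hc : (m : ℝ) + 2 + n - 1 - m = n + 1 := by ring
      rw [hc]
      calc δ ^ n * (((n : ℝ) + 1) * (α * ρ * (1 + L / μc) * ‖φ₁ - φ₂‖))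
          = α * (n + 1) * ρ * (1 + L / μc) * δ ^ n * ‖φ₁ - φ₂‖ := by ring
        _ ≤ _ := by
          gcongr
          linarith
  · intro k
    have e : (1 - α • hessW LS (innerIter LS α (m + 1 + k) w₁ φ₁) φ₁)
        - (1 - α • hessW LS (innerIter LS α (m + 1 + k) w₂ φ₂) φ₂)
        = -(α • (hessW LS (innerIter LS α (m + 1 + k) w₁ φ₁) φ₁
            - hessW LS (innerIter LS α (m + 1 + k) w₂ φ₂) φ₂)) := by
      rw [smul_sub]; abel
    simp only [e]
    rw [norm_neg, norm_smul, Real.norm_of_nonneg hαp.le]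
    have h1 := hHess (innerIter LS α (m + 1 + k) w₁ φ₁) (innerIter LS α (m + 1 + k) w₂ φ₂) φ₁ φ₂
    have h2 := AnilAux.iter_lip hLS hLip hSC hL.le hμ hαp.le hαL.le hδ0 w₁ w₂ φ₁ φ₂ (m + 1 + k)
    rw [← hδ] at h2
    set d := ‖innerIter LS α (m + 1 + k) w₁ φ₁ - innerIter LS α (m + 1 + k) w₂ φ₂‖
    have h3 : Real.sqrt (d ^ 2 + ‖φ₁ - φ₂‖ ^ 2) ≤ d + ‖φ₁ - φ₂‖ := by
      have hd : 0 ≤ d := norm_nonneg _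
      apply Real.sqrt_le_iff.mpr
      refine ⟨by positivity, ?_⟩
      nlinarith [mul_nonneg hd (norm_nonneg (φ₁ - φ₂))]
    calc _ ≤ α * (ρ * ((δ ^ (m + 1 + k) * ‖w₁ - w₂‖ + L / μc * ‖φ₁ - φ₂‖) + ‖φ₁ - φ₂‖)) := by
          gcongr
          refine h1.trans ?_
          gcongr
          linarith
      _ = _ := by rw [pow_add δ (m + 1) k]; ring
end
end
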